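/- arXiv:1605.08819 — 2 statements merged into one kernel-verified Lean document; each statement's English description precedes it below -/
import Mathlib

section
/- For every integer n ≥ 1 and every real number α, ∑_{k=1}^{n} (−1)^{n−k} S(n,k) · k! · α^{k−1} = ∑_{c ∈ Comp(n)} (α−1)^{ℓ(c)−1} · binom(n; c), where the right-hand sum is over all compositions c of n. (This identity expresses that the Euler characteristic of the α-colored permutohedron P_n^α can be computed in two ways.) -/
/-- Stirling numbers of the second kind. -/
def stirling : ℕ → ℕ → ℕ
  | 0, 0 => 1
  | 0, _ + 1 => 0
  | _ + 1, 0 => 0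
  | n + 1, k + 1 => (k + 1) * stirling n (k + 1) + stirling n k

/-- The multinomial coefficient `binom(n; c) = n!/(c_1!·c_2!·⋯·c_ℓ!)`
associated to a composition `c` of `n` (the division is exact). -/
def compMultinomial {n : ℕ} (c : Composition n) : ℕ :=
  Nat.factorial n / (c.blocks.map Nat.factorial).prod

theorem stirling_eq_zero_of_lt : ∀ {n k : ℕ}, n < k → stirling n k = 0
  | 0, _ + 1, _ => rfl
  | n + 1, k + 1, h => by
    rw [stirling, stirling_eq_zero_of_lt (by omega : n < k + 1),
      stirling_eq_zero_of_lt (by omega : n < k), mul_zero]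

/-- The signed number of surjections from an `n`-set onto a `k`-set. -/
def signedSurj (n k : ℕ) : ℝ :=
  (-1) ^ (n + k) * (stirling n k * Nat.factorial k)

theorem signedSurj_succ_zero (n : ℕ) : signedSurj (n + 1) 0 = 0 := by
  simp [signedSurj, stirling]

theorem signedSurj_zero_zero : signedSurj 0 0 = 1 := by
  simp [signedSurj, stirling]

theorem signedSurj_eq_zero_of_lt {n k : ℕ} (h : n < k) : signedSurj n k = 0 := by
  simp [signedSurj, stirling_eq_zero_of_lt h]

theorem signedSurj_succ_succ (n k : ℕ) :
    signedSurj (n + 1) (k + 1) = (k + 1) * (signedSurj n k - signedSurj n (k + 1)) := by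
  simp only [signedSurj, stirling, Nat.factorial_succ]
  push_cast
  ring

/-- The binomial transform of a real sequence. -/
def binomTransform (f : ℕ → ℝ) (n : ℕ) : ℝ :=
  ∑ m ∈ Finset.range (n + 1), (n.choose m : ℝ) * f m

theorem binomTransform_succ (f : ℕ → ℝ) (n : ℕ) :
    binomTransform f (n + 1) = binomTransform f n + binomTransform (fun m => f (m + 1)) n := by
  exact Finset.sum_choose_succ_mul (fun m _ => f m) n

theorem binomTransform_signedSurj_zero (n : ℕ) :
    binomTransform (fun m => signedSurj m 0) n = 1 := by
  rw [binomTransform, Finset.sum_range_succ']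
  simp [signedSurj_succ_zero, signedSurj_zero_zero]

theorem binomTransform_signedSurj_succ_succ (n k : ℕ) :
    binomTransform (fun m => signedSurj m (k + 1)) (n + 1) =
      binomTransform (fun m => signedSurj m (k + 1)) n +
        (k + 1) * (binomTransform (fun m => signedSurj m k) n -
          binomTransform (fun m => signedSurj m (k + 1)) n) := by
  rw [binomTransform_succ]
  congr 1
  simp only [binomTransform, signedSurj_succ_succ, ← Finset.sum_sub_distrib, Finset.mul_sum]
  exact Finset.sum_congr rfl fun _ _ => by ring

theorem binomTransform_signedSurj_succ (n k : ℕ) :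
    binomTransform (fun m => signedSurj m (k + 1)) n =
      binomTransform (fun m => signedSurj m k) n - signedSurj n k := by
  induction n generalizing k with
  | zero =>
    simp [binomTransform, signedSurj_eq_zero_of_lt]
  | succ n ih =>
    rw [binomTransform_signedSurj_succ_succ, ih k]
    cases k with
    | zero =>
      simp [binomTransform_signedSurj_zero, signedSurj_succ_zero]
    | succ k =>
      rw [binomTransform_signedSurj_succ_succ, ih k, signedSurj_succ_succ]
      push_cast
      ring

/-- The polynomial `∑_{k ≥ 1} (-1)^(n-k) S(n,k) k! α^(k-1)`. -/
def surjPoly (α : ℝ) (n : ℕ) : ℝ :=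
  ∑ k ∈ Finset.range n, signedSurj n (k + 1) * α ^ k

theorem surjPoly_zero (α : ℝ) : surjPoly α 0 = 0 := rfl

theorem surjPoly_eq_sum_range {n N : ℕ} (h : n ≤ N) (α : ℝ) :
    surjPoly α n = ∑ k ∈ Finset.range N, signedSurj n (k + 1) * α ^ k := by
  refine Finset.sum_subset (Finset.range_subset_range.2 h) fun k _ hk => ?_
  rw [signedSurj_eq_zero_of_lt (by simpa [Nat.lt_succ_iff] using hk), zero_mul]

theorem sum_range_signedSurj_mul_pow {n N : ℕ} (h : n ≤ N) (α : ℝ) :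
    ∑ k ∈ Finset.range (N + 1), signedSurj n k * α ^ k =
      signedSurj n 0 + α * surjPoly α n := by
  rw [Finset.sum_range_succ', surjPoly_eq_sum_range h, Finset.mul_sum, add_comm]
  simp only [pow_zero, mul_one]
  congr 1
  exact Finset.sum_congr rfl fun _ _ => by ring

theorem binomTransform_surjPoly (α : ℝ) (n : ℕ) :
    binomTransform (surjPoly α) n =
      1 + α * binomTransform (surjPoly α) n - (signedSurj n 0 + α * surjPoly α n) := by
  have key := Finset.sum_congr (rfl : Finset.range (n + 1) = _) fun k _ =>
    congrArg (· * α ^ k) (binomTransform_signedSurj_succ n k)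
  simp only [sub_mul, Finset.sum_sub_distrib] at key
  rw [sum_range_signedSurj_mul_pow le_rfl] at key
  simp only [binomTransform, Finset.sum_mul, mul_assoc] at key
  rw [Finset.sum_comm, Finset.sum_comm (s := Finset.range (n + 1)) (f := fun k m =>
    (n.choose m : ℝ) * (signedSurj m k * α ^ k))] at key
  simp only [← Finset.mul_sum] at key
  have left : ∑ m ∈ Finset.range (n + 1), (n.choose m : ℝ) *
      ∑ k ∈ Finset.range (n + 1), signedSurj m (k + 1) * α ^ k =
        binomTransform (surjPoly α) n :=
    Finset.sum_congr rfl fun m hm => by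
      rw [surjPoly_eq_sum_range (Finset.mem_range.1 hm).le]
  have right : ∑ m ∈ Finset.range (n + 1), (n.choose m : ℝ) *
      ∑ k ∈ Finset.range (n + 1), signedSurj m k * α ^ k =
        1 + α * binomTransform (surjPoly α) n := by
    rw [← binomTransform_signedSurj_zero n, binomTransform, binomTransform, Finset.mul_sum,
      ← Finset.sum_add_distrib]
    refine Finset.sum_congr rfl fun m hm => ?_
    rw [sum_range_signedSurj_mul_pow (Nat.lt_succ_iff.1 (Finset.mem_range.1 hm))]
    ring
  rw [left, right] at key
  exact key

theorem surjPoly_succ (α : ℝ) (n : ℕ) :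
    surjPoly α (n + 1) = 1 + (α - 1) *
      ∑ m ∈ Finset.range (n + 1), ((n + 1).choose m : ℝ) * surjPoly α m := by
  have h := binomTransform_surjPoly α (n + 1)
  rw [signedSurj_succ_zero, binomTransform, Finset.sum_range_succ, Nat.choose_self] at h
  push_cast at h
  linarith

theorem List.prod_map_factorial_dvd (l : List ℕ) :
    (l.map Nat.factorial).prod ∣ l.sum.factorial := by
  induction l with
  | nil => simp
  | cons a l ih =>
    simp only [List.map_cons, List.prod_cons, List.sum_cons]
    exact (mul_dvd_mul_left _ ih).trans (Nat.factorial_mul_factorial_dvd_factorial_add a l.sum)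

/-- Prepend to a composition of `m < n` the block completing it to a composition of `n`. -/
def Composition.consComplement {m n : ℕ} (h : m < n) (c : Composition m) : Composition n where
  blocks := (n - m) :: c.blocks
  blocks_pos := by
    intro i hi
    rcases List.mem_cons.1 hi with rfl | hi
    · omega
    · exact c.blocks_pos hi
  blocks_sum := by
    rw [List.sum_cons, c.blocks_sum]
    omega

theorem Composition.consComplement_bijective (n : ℕ) :
    Function.Bijective fun p : Σ m : Fin (n + 1), Composition m =>
      (p.2.consComplement p.1.2 : Composition (n + 1)) := by
  constructor
  · rintro ⟨⟨m, hm⟩, c⟩ ⟨⟨m', hm'⟩, c'⟩ h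
    have hb := congrArg Composition.blocks h
    simp only [consComplement, List.cons.injEq] at hb
    obtain rfl : m = m' := by omega
    obtain rfl : c = c' := Composition.ext hb.2
    rfl
  · rintro ⟨_ | ⟨a, l⟩, hpos, hsum⟩
    · simp at hsum
    · have ha : 0 < a := hpos (by simp)
      rw [List.sum_cons] at hsum
      refine ⟨⟨⟨l.sum, by omega⟩, ⟨l, fun hi => hpos (List.mem_cons_of_mem _ hi), rfl⟩⟩, ?_⟩
      apply Composition.ext
      simp only [consComplement, List.cons.injEq, and_true]
      omega

theorem compMultinomial_consComplement {m n : ℕ} (h : m < n) (c : Composition m) :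
    compMultinomial (c.consComplement h) = n.choose m * compMultinomial c := by
  have hd : (c.blocks.map Nat.factorial).prod ∣ m.factorial := by
    simpa only [c.blocks_sum] using List.prod_map_factorial_dvd c.blocks
  unfold compMultinomial
  rw [← Nat.mul_div_assoc _ hd, ← Nat.choose_mul_factorial_mul_factorial h.le]
  simp only [Composition.consComplement, List.map_cons, List.prod_cons]
  rw [mul_comm _ (n - m).factorial, Nat.mul_div_mul_left _ _ (Nat.factorial_pos _)]

theorem sum_composition_succ (x : ℝ) (n : ℕ) :
    ∑ c : Composition (n + 1), x ^ (c.length - 1) * (compMultinomial c : ℝ) =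
      ∑ m ∈ Finset.range (n + 1), ((n + 1).choose m : ℝ) *
        ∑ c : Composition m, x ^ c.length * (compMultinomial c : ℝ) := by
  rw [← (Composition.consComplement_bijective n).sum_comp, Fintype.sum_sigma,
    ← Fin.sum_univ_eq_sum_range (fun m => ((n + 1).choose m : ℝ) *
        ∑ c : Composition m, x ^ c.length * (compMultinomial c : ℝ))]
  refine Finset.sum_congr rfl fun m _ => ?_
  rw [Finset.mul_sum]
  refine Finset.sum_congr rfl fun c _ => ?_
  rw [compMultinomial_consComplement]
  simp only [Composition.length, Composition.consComplement, List.length_cons,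
    Nat.add_sub_cancel]
  push_cast
  ring

theorem sum_composition_zero (x : ℝ) :
    ∑ c : Composition 0, x ^ c.length * (compMultinomial c : ℝ) = 1 := by
  have : Subsingleton (Composition 0) :=
    ⟨fun c d => Composition.ext ((c.blocks_eq_nil.2 rfl).trans (d.blocks_eq_nil.2 rfl).symm)⟩
  rw [Fintype.sum_subsingleton _ (Composition.ones 0)]
  simp [compMultinomial]

theorem sum_composition_pow_length (x : ℝ) {n : ℕ} (hn : 0 < n) :
    ∑ c : Composition n, x ^ c.length * (compMultinomial c : ℝ) =
      x * ∑ c : Composition n, x ^ (c.length - 1) * (compMultinomial c : ℝ) := by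
  rw [Finset.mul_sum]
  refine Finset.sum_congr rfl fun c _ => ?_
  rw [← mul_assoc, mul_pow_sub_one (c.length_pos_iff.2 hn).ne']

theorem sum_composition_eq_surjPoly (α : ℝ) (n : ℕ) :
    ∑ c : Composition (n + 1), (α - 1) ^ (c.length - 1) * (compMultinomial c : ℝ) =
      surjPoly α (n + 1) := by
  induction n using Nat.strong_induction_on with
  | _ n ih =>
    rw [sum_composition_succ, surjPoly_succ, Finset.sum_range_succ', Finset.sum_range_succ',
      sum_composition_zero, surjPoly_zero, mul_zero, add_zero, Finset.mul_sum, add_comm]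
    congr 1
    · simp
    · refine Finset.sum_congr rfl fun m hm => ?_
      rw [sum_composition_pow_length _ m.succ_pos, ih m (Finset.mem_range.1 hm)]
      ring

/-- For `n ≥ 1` and real `α`,
`∑_{k=1}^{n} (−1)^{n−k} S(n,k)·k!·α^{k−1}
  = ∑_{c ∈ Comp(n)} (α−1)^{ℓ(c)−1}·binom(n; c)`. -/
theorem stmt6 (n : ℕ) (hn : 1 ≤ n) (α : ℝ) :
    ∑ k ∈ Finset.Icc 1 n,
        (-1 : ℝ) ^ (n - k) * (stirling n k * Nat.factorial k : ℝ) * α ^ (k - 1)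
      = ∑ c : Composition n, (α - 1) ^ (c.length - 1) * (compMultinomial c : ℝ) := by
  obtain ⟨n, rfl⟩ := Nat.exists_eq_add_of_le' hn
  rw [sum_composition_eq_surjPoly, surjPoly, Finset.range_eq_Ico]
  refine Eq.trans ?_
    (Finset.sum_Ico_add' (fun k => signedSurj (n + 1) k * α ^ (k - 1)) 0 (n + 1) 1).symm
  refine Finset.sum_congr (by ext; simp) fun k hk => ?_
  obtain ⟨d, hd⟩ := Nat.exists_eq_add_of_le (Finset.mem_Icc.1 hk).2
  rw [signedSurj, hd, Nat.add_sub_cancel_left, (by ring : k + d + k = d + 2 * k), pow_add,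
    pow_mul (-1 : ℝ) 2 k]
  simp
end

section
/- For every integer n ≥ 1 and every real number α with α ≠ 0 and α ≠ 1, ∑_{c ∈ Comp(n)} (α−1)^{ℓ(c)−1} · binom(n; c) = ((α−1)^n / α) · A_n(α/(α−1)), where the left-hand sum is over all compositions c of n and A_n is the Eulerian polynomial. (This computes the Euler characteristic of the α-colored permutohedron P_n^α via the Eulerian polynomial.) -/
def finLo {N : ℕ} (i : Fin (N - 1)) : Fin N := ⟨i.val, by have := i.isLt; omega⟩
def finHi {N : ℕ} (i : Fin (N - 1)) : Fin N := ⟨i.val + 1, by have := i.isLt; omega⟩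

/-- The number of descents of a permutation of `Fin N`:
`d(π) = #{i : π(i) > π(i+1)}`. -/
def descents {N : ℕ} (π : Equiv.Perm (Fin N)) : ℕ :=
  (Finset.univ.filter fun i : Fin (N - 1) => π (finHi i) < π (finLo i)).card

open Polynomial in
/-- The ordered Bell (Fubini) polynomials `∑ₖ k! S(n,k) Xᵏ`. -/
noncomputable def fubiniPoly : ℕ → ℝ[X]
  | 0 => 1
  | n + 1 => X * derivative ((1 + X) * fubiniPoly n)

section FubiniPoly
open Polynomial Finset

theorem sum_choose_mul_fubiniPoly_succ (n : ℕ) :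
    ∑ j ∈ range (n + 2), ((n + 1).choose j : ℝ[X]) * fubiniPoly j
      = ∑ j ∈ range (n + 1), (n.choose j : ℝ[X]) * fubiniPoly j
        + X * derivative ((1 + X) * ∑ j ∈ range (n + 1), (n.choose j : ℝ[X]) * fubiniPoly j) := by
  have shift : X * derivative ((1 + X) * ∑ j ∈ range (n + 1), (n.choose j : ℝ[X]) * fubiniPoly j)
      = ∑ j ∈ range (n + 1), (n.choose j : ℝ[X]) * fubiniPoly (j + 1) := by
    rw [mul_sum, derivative_sum, mul_sum]
    refine sum_congr rfl fun j _ => ?_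
    rw [mul_left_comm, derivative_natCast_mul, fubiniPoly]
    ring
  rw [shift, sum_range_succ' _ (n + 1)]
  simp only [Nat.choose_succ_succ, Nat.cast_add, add_mul, sum_add_distrib]
  have tail := sum_range_succ' (fun j => (n.choose j : ℝ[X]) * fubiniPoly j) (n + 1)
  rw [sum_range_succ] at tail
  simp only [Nat.choose_succ_self, Nat.cast_zero, zero_mul, add_zero] at tail
  rw [tail]
  simp
  ring

theorem one_add_X_mul_fubiniPoly (n : ℕ) :
    (1 + X) * fubiniPoly n
      = X * ∑ j ∈ range (n + 1), (n.choose j : ℝ[X]) * fubiniPoly j + if n = 0 then 1 else 0 := by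
  induction n with
  | zero => simp [fubiniPoly, add_comm]
  | succ n ih =>
    have dih := congrArg derivative ih
    rw [sum_choose_mul_fubiniPoly_succ, fubiniPoly, dih]
    have : derivative (if n = 0 then (1 : ℝ[X]) else 0) = 0 := by split_ifs <;> simp
    simp only [derivative_add, derivative_mul, this, derivative_X, derivative_one]
    simp
    ring

theorem fubiniPoly_succ_eq_sum (n : ℕ) :
    fubiniPoly (n + 1)
      = X * ∑ j ∈ range (n + 1), ((n + 1).choose j : ℝ[X]) * fubiniPoly j := by
  have h := one_add_X_mul_fubiniPoly (n + 1)
  rw [sum_range_succ] at h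
  simp only [Nat.choose_self, Nat.cast_one, one_mul, Nat.add_eq_zero_iff, one_ne_zero, and_false,
    if_false, add_zero] at h
  linear_combination h

end FubiniPoly

namespace Composition

theorem prod_factorial_dvd_factorial_sum (l : List ℕ) :
    (l.map Nat.factorial).prod ∣ Nat.factorial l.sum := by
  induction l with
  | nil => simp
  | cons a l ih =>
    simp only [List.map_cons, List.prod_cons, List.sum_cons]
    exact (mul_dvd_mul_left _ ih).trans (Nat.factorial_mul_factorial_dvd_factorial_add _ _)

/-- Splitting off the first block of a composition of `n + 1`. -/
def consEquiv (n : ℕ) : (Σ j : Fin (n + 1), Composition j) ≃ Composition (n + 1) where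
  toFun x :=
    { blocks := (n + 1 - x.1) :: x.2.blocks
      blocks_pos := by
        intro i hi
        have := x.1.isLt
        rcases List.mem_cons.1 hi with rfl | hi
        · omega
        · exact x.2.blocks_pos hi
      blocks_sum := by
        have := x.1.isLt
        rw [List.sum_cons, x.2.blocks_sum]
        omega }
  invFun c :=
    ⟨⟨c.blocks.tail.sum, by
        rcases c with ⟨_ | ⟨a, l⟩, hpos, hsum⟩
        · simp at hsum
        · have := hpos (i := a) (by simp)
          simp at hsum ⊢
          omega⟩,
      { blocks := c.blocks.tail
        blocks_pos := fun hi => c.blocks_pos (List.mem_of_mem_tail hi)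
        blocks_sum := rfl }⟩
  left_inv := by
    rintro ⟨⟨j, hj⟩, ⟨l, hl, hsum⟩⟩
    change l.sum = j at hsum
    subst hsum
    rfl
  right_inv := by
    rintro ⟨_ | ⟨a, l⟩, hpos, hsum⟩
    · simp at hsum
    · ext1
      simp at hsum ⊢
      omega

theorem cast_compMultinomial {n : ℕ} (c : Composition n) :
    (compMultinomial c : ℝ) = (n.factorial : ℝ) / (c.blocks.map Nat.factorial).prod := by
  have hdvd := prod_factorial_dvd_factorial_sum c.blocks
  rw [c.blocks_sum] at hdvd
  refine Nat.cast_div hdvd ?_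
  rw [Nat.cast_ne_zero]
  exact List.prod_ne_zero (by simp [Nat.factorial_ne_zero])

theorem length_consEquiv {n : ℕ} (j : Fin (n + 1)) (c : Composition j) :
    (consEquiv n ⟨j, c⟩).length = c.length + 1 := rfl

theorem cast_compMultinomial_consEquiv {n : ℕ} (j : Fin (n + 1)) (c : Composition j) :
    (compMultinomial (consEquiv n ⟨j, c⟩) : ℝ) = (n + 1).choose j * compMultinomial c := by
  rw [cast_compMultinomial, cast_compMultinomial, Nat.cast_choose ℝ j.isLt.le]
  have hj : (Nat.factorial j : ℝ) ≠ 0 := by exact_mod_cast Nat.factorial_ne_zero _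
  simp only [consEquiv, Equiv.coe_fn_mk, List.map_cons, List.prod_cons, Nat.cast_mul]
  rw [div_mul_div_comm, mul_comm _ (Nat.factorial j : ℝ), mul_assoc, mul_div_mul_left _ _ hj]

open Polynomial in
theorem sum_compMultinomial_mul_X_pow (n : ℕ) :
    ∑ c : Composition n, C (compMultinomial c : ℝ) * X ^ c.length = fubiniPoly n := by
  induction n using Nat.strong_induction_on with
  | _ n ih =>
    cases n with
    | zero =>
      have : Subsingleton (Composition 0) :=
        Fintype.card_le_one_iff_subsingleton.1 (composition_card 0).le
      have hblocks : (default : Composition 0).blocks = [] :=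
        List.eq_nil_of_length_eq_zero (Nat.le_zero.1 (default : Composition 0).length_le)
      rw [Fintype.sum_subsingleton _ default]
      simp [fubiniPoly, cast_compMultinomial, Composition.length, hblocks]
    | succ n =>
      rw [← (consEquiv n).sum_comp, Fintype.sum_sigma, fubiniPoly_succ_eq_sum, Finset.sum_range,
        Finset.mul_sum]
      refine Finset.sum_congr rfl fun j _ => ?_
      rw [← ih j j.isLt, Finset.mul_sum, Finset.mul_sum]
      refine Finset.sum_congr rfl fun c _ => ?_
      rw [length_consEquiv, cast_compMultinomial_consEquiv, C_mul, C_eq_natCast, pow_succ]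
      simp only [map_natCast]
      ring

end Composition

section Descents
open Finset

/-- The permutation whose one-line notation is that of `π` with the new maximum inserted at
position `p`. -/
def insertMax {n : ℕ} (p : Fin (n + 1)) (π : Equiv.Perm (Fin n)) : Equiv.Perm (Fin (n + 1)) :=
  (finSuccEquiv' p).trans ((Equiv.optionCongr π).trans (finSuccEquiv' (Fin.last n)).symm)

theorem insertMax_self {n : ℕ} (p : Fin (n + 1)) (π : Equiv.Perm (Fin n)) :
    insertMax p π p = Fin.last n := by
  simp [insertMax]

theorem insertMax_succAbove {n : ℕ} (p : Fin (n + 1)) (π : Equiv.Perm (Fin n)) (k : Fin n) :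
    insertMax p π (p.succAbove k) = (π k).castSucc := by
  simp [insertMax]

theorem bijective_insertMax (n : ℕ) :
    Function.Bijective fun x : Equiv.Perm (Fin n) × Fin (n + 1) => insertMax x.2 x.1 := by
  rw [Fintype.bijective_iff_injective_and_card]
  constructor
  · rintro ⟨π, p⟩ ⟨ρ, q⟩ h
    have hpq : p = q := (insertMax q ρ).injective <| by
      rw [insertMax_self, ← insertMax_self p π]
      exact (congrArg (· p) h).symm
    subst hpq
    refine Prod.ext (Equiv.ext fun k => ?_) rfl
    have := congrArg (· (p.succAbove k)) h
    simpa only [insertMax_succAbove, Fin.castSucc_inj] using this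
  · simp [Fintype.card_perm, Nat.factorial_succ, mul_comm]

theorem descents_eq_sum {m : ℕ} (π : Equiv.Perm (Fin (m + 1))) :
    descents π = ∑ i : Fin m, if π i.succ < π i.castSucc then 1 else 0 :=
  card_filter _ _

theorem insertMax_of_lt {n : ℕ} {p : Fin (n + 1)} (π : Equiv.Perm (Fin n)) {i : Fin (n + 1)}
    {k : Fin n} (hk : (k : ℕ) < p) (hi : (i : ℕ) = k) : insertMax p π i = (π k).castSucc := by
  rw [← insertMax_succAbove p π k, Fin.succAbove_of_castSucc_lt _ _ hk]
  exact congrArg _ (Fin.ext hi)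

theorem insertMax_of_le {n : ℕ} {p : Fin (n + 1)} (π : Equiv.Perm (Fin n)) {i : Fin (n + 1)}
    {k : Fin n} (hk : (p : ℕ) ≤ k) (hi : (i : ℕ) = k + 1) :
    insertMax p π i = (π k).castSucc := by
  rw [← insertMax_succAbove p π k, Fin.succAbove_of_le_castSucc _ _ hk]
  exact congrArg _ (Fin.ext hi)

theorem descents_insertMax_last {m : ℕ} (π : Equiv.Perm (Fin (m + 1))) :
    descents (insertMax (Fin.last _) π) = descents π := by
  rw [descents_eq_sum, descents_eq_sum, Fin.sum_univ_castSucc, Fin.succ_last, insertMax_self,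
    if_neg (Fin.le_last _).not_gt, add_zero]
  refine sum_congr rfl fun j _ => ?_
  rw [insertMax_of_lt (k := j.succ) π (by simp) (by simp),
    insertMax_of_lt (k := j.castSucc) π (by simp) (by simp)]
  simp

theorem descents_insertMax_castSucc {m : ℕ} (q : Fin (m + 1)) (π : Equiv.Perm (Fin (m + 1))) :
    descents (insertMax q.castSucc π)
      = 1 + ∑ j : Fin m, if j.succ = q then 0 else if π j.succ < π j.castSucc then 1 else 0 := by
  rw [descents_eq_sum, Fin.sum_univ_succAbove _ q]
  congr 1
  · rw [insertMax_self, insertMax_of_le (k := q) π (by simp) (by simp),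
      if_pos (Fin.castSucc_lt_last _)]
  · refine sum_congr rfl fun j _ => ?_
    rcases lt_or_ge j.castSucc q with hj | hj
    · rw [Fin.succAbove_of_castSucc_lt _ _ hj]
      have hj' : (j : ℕ) < q := hj
      rw [insertMax_of_lt (k := j.castSucc) (i := j.castSucc.castSucc) π (by simpa) (by simp)]
      by_cases hq : j.succ = q
      · rw [if_pos hq, ← hq, show j.castSucc.succ = j.succ.castSucc from rfl, insertMax_self,
          if_neg (Fin.le_last _).not_gt]
      · have hne : (j : ℕ) + 1 ≠ q := fun h => hq (Fin.ext h)
        rw [if_neg hq, insertMax_of_lt (k := j.succ) π (by simp; omega) (by simp)]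
        simp
    · rw [Fin.succAbove_of_le_castSucc _ _ hj]
      have hj' : (q : ℕ) ≤ j := hj
      have hq : j.succ ≠ q := fun h => by simp [← h] at hj'
      rw [if_neg hq,
        insertMax_of_le (k := j.succ) π (by simp; omega) (by simp),
        insertMax_of_le (k := j.castSucc) π (by simpa) (by simp)]
      simp

theorem descents_insertMax_zero {m : ℕ} (π : Equiv.Perm (Fin (m + 1))) :
    descents (insertMax 0 π) = descents π + 1 := by
  have h := descents_insertMax_castSucc 0 π
  simp only [Fin.castSucc_zero, Fin.succ_ne_zero, if_false] at h
  rw [h, descents_eq_sum, add_comm]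

theorem descents_insertMax_succ {m : ℕ} (r : Fin m) (π : Equiv.Perm (Fin (m + 1))) :
    descents (insertMax r.succ.castSucc π)
      = if π r.succ < π r.castSucc then descents π else descents π + 1 := by
  have hsum := sum_ite_eq' univ r fun j : Fin m => if π j.succ < π j.castSucc then 1 else 0
  have hsplit : descents π = (∑ j : Fin m, if j.succ = r.succ then 0
      else if π j.succ < π j.castSucc then 1 else 0)
      + ∑ j : Fin m, if j = r then (if π j.succ < π j.castSucc then 1 else 0) else 0 := by
    rw [descents_eq_sum, ← sum_add_distrib]
    refine sum_congr rfl fun j _ => ?_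
    simp only [Fin.succ_inj]
    split_ifs <;> rfl
  rw [hsum] at hsplit
  rw [descents_insertMax_castSucc]
  simp only [mem_univ, if_true] at hsplit
  split_ifs at hsplit ⊢ <;> omega

theorem descents_le {m : ℕ} (π : Equiv.Perm (Fin (m + 1))) : descents π ≤ m :=
  (card_filter_le _ _).trans (by simp)

theorem sum_descents_insertMax {M : Type*} [AddCommMonoid M] {m : ℕ}
    (π : Equiv.Perm (Fin (m + 1))) (f : ℕ → M) :
    ∑ p, f (descents (insertMax p π))
      = (descents π + 1) • f (descents π) + (m - descents π + 1) • f (descents π + 1) := by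
  have hdes : #{r : Fin m | π r.succ < π r.castSucc} = descents π := rfl
  have hasc : #{r : Fin m | ¬ π r.succ < π r.castSucc} = m - descents π := by
    have := card_filter_add_card_filter_not (s := univ)
      fun r : Fin m => π r.succ < π r.castSucc
    rw [hdes, card_univ, Fintype.card_fin] at this
    omega
  rw [Fin.sum_univ_castSucc, Fin.sum_univ_succ]
  simp only [Fin.castSucc_zero, descents_insertMax_zero, descents_insertMax_last,
    descents_insertMax_succ, apply_ite f, sum_ite, sum_const, hdes, hasc, add_smul, one_smul]
  abel

open Polynomial in
theorem X_mul_sum_descents (m : ℕ) :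
    X * ∑ π : Equiv.Perm (Fin (m + 1)), X ^ (m - descents π) * (1 + X) ^ descents π
      = fubiniPoly (m + 1) := by
  induction m with
  | zero =>
    have h (π : Equiv.Perm (Fin 1)) : descents π = 0 := Nat.le_zero.1 (descents_le π)
    simp [fubiniPoly, h]
  | succ m ih =>
    rw [fubiniPoly, ← ih, ← (bijective_insertMax (m + 1)).sum_comp, Fintype.sum_prod_type]
    congr 1
    rw [mul_sum, mul_sum, derivative_sum]
    refine sum_congr rfl fun π _ => ?_
    rw [sum_descents_insertMax π fun d => X ^ (m + 1 - d) * (1 + X : ℝ[X]) ^ d]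
    obtain ⟨a, ha⟩ := Nat.exists_eq_add_of_le (descents_le π)
    rw [show m - descents π = a by omega, show m + 1 - descents π = a + 1 by omega,
      show m + 1 - (descents π + 1) = a by omega,
      show (1 + X : ℝ[X]) * (X * (X ^ a * (1 + X) ^ descents π))
        = X ^ (a + 1) * (1 + X) ^ (descents π + 1) by ring]
    simp only [derivative_mul, derivative_pow, derivative_add, derivative_one,
      derivative_X, nsmul_eq_mul, Nat.add_sub_cancel, map_natCast]
    ring

end Descents

/-- For `n ≥ 1` and real `α ∉ {0, 1}`,
`∑_{c ∈ Comp(n)} (α−1)^{ℓ(c)−1}·binom(n; c) = ((α−1)^n/α)·A_n(α/(α−1))`,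
where `A_n(x) = ∑_{π ∈ S_n} x^{1+d(π)}` is the Eulerian polynomial. -/
theorem stmt8 (n : ℕ) (hn : 1 ≤ n) (α : ℝ) (h0 : α ≠ 0) (h1 : α ≠ 1) :
    ∑ c : Composition n, (α - 1) ^ (c.length - 1) * (compMultinomial c : ℝ)
      = ((α - 1) ^ n / α) *
          ∑ π : Equiv.Perm (Fin n), (α / (α - 1)) ^ (1 + descents π) := by
  obtain ⟨m, rfl⟩ := Nat.exists_eq_add_of_le' hn
  have ht : α - 1 ≠ 0 := sub_ne_zero.2 h1
  have key := congrArg (Polynomial.eval (α - 1))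
    ((Composition.sum_compMultinomial_mul_X_pow (m + 1)).trans (X_mul_sum_descents m).symm)
  simp only [Polynomial.eval_finsetSum, Polynomial.eval_mul, Polynomial.eval_pow,
    Polynomial.eval_X, Polynomial.eval_C, Polynomial.eval_add, Polynomial.eval_one,
    add_sub_cancel] at key
  refine mul_left_cancel₀ ht ?_
  calc _ = ∑ c : Composition (m + 1), (compMultinomial c : ℝ) * (α - 1) ^ c.length := by
        rw [Finset.mul_sum]
        refine Finset.sum_congr rfl fun c _ => ?_
        rw [← mul_assoc, mul_pow_sub_one (c.length_pos_of_pos m.succ_pos).ne', mul_comm]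
    _ = _ := by
        rw [key, Finset.mul_sum (a := _ / α)]
        congr 1
        refine Finset.sum_congr rfl fun π _ => ?_
        obtain ⟨a, ha⟩ := Nat.exists_eq_add_of_le (descents_le π)
        have hpow : (α - 1) ^ (m + 1) = (α - 1) ^ a * (α - 1) ^ (1 + descents π) := by
          rw [← pow_add]
          congr 1
          omega
        rw [show m - descents π = a by omega, hpow, div_pow, pow_add α]
        field_simp
end
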